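/- For every Δ⁰₂ set D: if for every ∅'-computable martingale M there exists a Δ⁰₂ set A on which M does not succeed and which has an infinite subset or cosubset computable in D, then ∅' ≤_T D. Equivalently, the only Δ⁰₂ almost s-Ramsey degree is 0'. -/

import Mathlib

/-!
Preamble: oracle computability, Turing reducibility, the jump, martingales,
and Martin-Löf randomness, developed from scratch.
-/

open scoped Classical

/-- The characteristic function of a set of naturals. -/
noncomputable def chi (A : Set ℕ) : ℕ → ℕ :=
  fun n => if n ∈ A then 1 else 0

/-- Partial functions recursive in a (total) oracle `O : ℕ → ℕ`.
This mirrors `Nat.Partrec`, with an additional constructor for the oracle. -/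
inductive RecIn (O : ℕ → ℕ) : (ℕ →. ℕ) → Prop
  | oracle : RecIn O (fun n => Part.some (O n))
  | zero : RecIn O (fun _ => Part.some 0)
  | succ : RecIn O (fun n => Part.some (n + 1))
  | left : RecIn O (fun n => Part.some (Nat.unpair n).1)
  | right : RecIn O (fun n => Part.some (Nat.unpair n).2)
  | pair {f g} : RecIn O f → RecIn O g → RecIn O (fun n => Nat.pair <$> f n <*> g n)
  | comp {f g} : RecIn O f → RecIn O g → RecIn O (fun n => g n >>= f)
  | prec {f g} :
      RecIn O f → RecIn O g →
      RecIn O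
        (Nat.unpaired fun a n =>
          n.rec (f a) fun y IH => do
            let i ← IH
            g (Nat.pair a (Nat.pair y i)))
  | rfind {f} :
      RecIn O f →
      RecIn O (fun a => Nat.rfind fun n => (fun m => m = 0) <$> f (Nat.pair a n))

/-- Codes for oracle machines. -/
inductive OCode : Type
  | zero : OCode
  | succ : OCode
  | left : OCode
  | right : OCode
  | oracle : OCode
  | pair : OCode → OCode → OCode
  | comp : OCode → OCode → OCode
  | prec : OCode → OCode → OCode
  | rfind' : OCode → OCode

/-- Evaluation of oracle codes relative to a total oracle. -/
def evalo (O : ℕ → ℕ) : OCode → ℕ →. ℕ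
  | .zero => fun _ => Part.some 0
  | .succ => fun n => Part.some (n + 1)
  | .left => fun n => Part.some (Nat.unpair n).1
  | .right => fun n => Part.some (Nat.unpair n).2
  | .oracle => fun n => Part.some (O n)
  | .pair cf cg => fun n => Nat.pair <$> evalo O cf n <*> evalo O cg n
  | .comp cf cg => fun n => evalo O cg n >>= evalo O cf
  | .prec cf cg =>
      Nat.unpaired fun a n =>
        n.rec (evalo O cf a) fun y IH => do
          let i ← IH
          evalo O cg (Nat.pair a (Nat.pair y i))
  | .rfind' cf =>
      Nat.unpaired fun a m =>
        (Nat.rfind fun n => (fun x => x = 0) <$> evalo O cf (Nat.pair a (n + m))).map (· + m)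

/-- A surjective listing of oracle codes. -/
def ofNatOCode : ℕ → OCode
  | 0 => .zero
  | 1 => .succ
  | 2 => .left
  | 3 => .right
  | 4 => .oracle
  | n + 5 =>
    have hm : n.div2.div2 < n + 5 := by
      rw [Nat.div2_val, Nat.div2_val]
      exact lt_of_le_of_lt (le_trans (Nat.div_le_self _ _) (Nat.div_le_self _ _))
        (Nat.lt_succ_of_le (Nat.le_add_right _ 4))
    have _m1 : n.div2.div2.unpair.1 < n + 5 :=
      lt_of_le_of_lt (Nat.unpair_left_le _) hm
    have _m2 : n.div2.div2.unpair.2 < n + 5 :=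
      lt_of_le_of_lt (Nat.unpair_right_le _) hm
    match n.bodd, n.div2.bodd with
    | false, false => .pair (ofNatOCode n.div2.div2.unpair.1) (ofNatOCode n.div2.div2.unpair.2)
    | false, true  => .comp (ofNatOCode n.div2.div2.unpair.1) (ofNatOCode n.div2.div2.unpair.2)
    | true , false => .prec (ofNatOCode n.div2.div2.unpair.1) (ofNatOCode n.div2.div2.unpair.2)
    | true , true  => .rfind' (ofNatOCode n.div2.div2)

/-- `Phi O e` is the `e`-th partial `O`-computable function `Φ_e^O`. -/
def Phi (O : ℕ → ℕ) (e : ℕ) : ℕ →. ℕ := evalo O (ofNatOCode e)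

/-- The Turing jump `A'` of a set `A`. -/
noncomputable def jump (A : Set ℕ) : Set ℕ := {e | (Phi (chi A) e e).Dom}

/-- The halting set `∅'`. -/
noncomputable def K : Set ℕ := jump ∅

/-- Turing reducibility between sets: `TRed B A` means `B ≤_T A`. -/
noncomputable def TRed (B A : Set ℕ) : Prop :=
  RecIn (chi A) (fun n => Part.some (chi B n))

/-- The effective join of two sets. -/
def join (A B : Set ℕ) : Set ℕ :=
  {n | (∃ a ∈ A, n = 2 * a) ∨ (∃ b ∈ B, n = 2 * b + 1)}

/-- A set is low if its jump is Turing reducible to `∅'`. -/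
noncomputable def Low (L : Set ℕ) : Prop := TRed (jump L) K

/-- The function `f : α → β` presented as an oracle on `ℕ`, via the encodings. -/
def fnOracle {α β : Type} [Encodable α] [Encodable β] (f : α → β) : ℕ → ℕ :=
  fun n => Encodable.encode ((Encodable.decode (α := α) n).map f)

/-- `FRed f A` means the function `f` is Turing reducible to the set `A`. -/
noncomputable def FRed {α β : Type} [Encodable α] [Encodable β] (f : α → β) (A : Set ℕ) : Prop :=
  RecIn (chi A) (fun n => Part.some (fnOracle f n))

/-- `FFRed g f` means the function `g` is Turing reducible to the function `f`. -/
def FFRed {α β γ δ : Type} [Encodable α] [Encodable β] [Encodable γ] [Encodable δ]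
    (g : γ → δ) (f : α → β) : Prop :=
  RecIn (fnOracle f) (fun n => Part.some (fnOracle g n))

/-- A martingale: a nonnegative rational-valued function on finite binary strings
satisfying the averaging condition `2 M(σ) = M(σ0) + M(σ1)`. -/
def IsMartingale (M : List Bool → ℚ) : Prop :=
  (∀ σ, 0 ≤ M σ) ∧ ∀ σ, 2 * M σ = M (σ ++ [false]) + M (σ ++ [true])

/-- The length-`n` initial segment of the characteristic sequence of `A`. -/
noncomputable def seg (A : Set ℕ) (n : ℕ) : List Bool :=
  (List.range n).map fun i => if i ∈ A then true else false

/-- A martingale succeeds on a set `A` if `limsup_n M(A↾n) = ∞`. -/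
noncomputable def Succeeds (M : List Bool → ℚ) (A : Set ℕ) : Prop :=
  ∀ q : ℚ, ∃ n, q < M (seg A n)

/-- `H(A)`: the mass problem of infinite subsets or cosubsets of `A`. -/
def Hset (A : Set ℕ) : Set (Set ℕ) :=
  {S | S.Infinite ∧ (S ⊆ A ∨ S ⊆ Aᶜ)}

/-- Muchnik reducibility: `MuchnikLe P Q` iff every member of `Q` computes a member of `P`. -/
noncomputable def MuchnikLe (P Q : Set (Set ℕ)) : Prop :=
  ∀ B ∈ Q, ∃ A ∈ P, TRed A B

/-- A set of naturals is computably enumerable. -/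
def CE (W : Set ℕ) : Prop :=
  ∃ g : ℕ →. ℕ, RecIn (fun _ => 0) g ∧ ∀ n, n ∈ W ↔ (g n).Dom

/-- A Martin-Löf test: a uniformly c.e. sequence of sets of strings `U n`,
with the open set generated by `U n` having measure at most `2^{-n}`. -/
def MLTest (U : ℕ → Set (List Bool)) : Prop :=
  CE {p : ℕ | ∃ σ ∈ U (Nat.unpair p).1, (Nat.unpair p).2 = Encodable.encode σ} ∧
  ∀ n, (∑' σ : (U n), ((1 : ENNReal) / 2) ^ (σ : List Bool).length) ≤ (1 / 2) ^ n

/-- A set is 1-random (Martin-Löf random) if for every Martin-Löf test there is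
an `n` such that no initial segment of the set lies in `U n`. -/
noncomputable def MLRandom (A : Set ℕ) : Prop :=
  ∀ U : ℕ → Set (List Bool), MLTest U → ∃ n, ∀ m, seg A m ∉ U n

section
open scoped Classical
open Encodable Denumerable

theorem RecIn.of_eq {O : ℕ → ℕ} {f g : ℕ →. ℕ} (hf : RecIn O f) (H : ∀ n, f n = g n) :
    RecIn O g := (funext H : f = g) ▸ hf

/-- total functions recursive in an oracle -/
def RecT (O : ℕ → ℕ) (f : ℕ → ℕ) : Prop := RecIn O (fun n => Part.some (f n))

theorem RecIn.of_partrec {O : ℕ → ℕ} {f : ℕ →. ℕ} (hf : Nat.Partrec f) : RecIn O f := by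
  induction hf with
  | zero => exact RecIn.zero
  | succ => exact RecIn.succ
  | left => exact RecIn.left
  | right => exact RecIn.right
  | pair _ _ h1 h2 => exact RecIn.pair h1 h2
  | comp _ _ h1 h2 => exact RecIn.comp h1 h2
  | prec _ _ h1 h2 => exact RecIn.prec h1 h2
  | rfind _ h => exact RecIn.rfind h

theorem RecT.of_computable {O : ℕ → ℕ} {f : ℕ → ℕ} (hf : Computable f) : RecT O f := by
  have : Nat.Partrec (fun n => Part.some (f n)) := Partrec.nat_iff.1 hf
  exact RecIn.of_partrec this

theorem RecT.of_primrec {O : ℕ → ℕ} {f : ℕ → ℕ} (hf : Primrec f) : RecT O f :=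
  RecT.of_computable hf.to_comp

theorem RecT.comp {O f g : ℕ → ℕ} (hf : RecT O f) (hg : RecT O g) :
    RecT O (fun n => f (g n)) := by
  have := RecIn.comp hf hg
  simpa [RecT] using this

theorem RecT.pair {O f g : ℕ → ℕ} (hf : RecT O f) (hg : RecT O g) :
    RecT O (fun n => Nat.pair (f n) (g n)) := by
  have := RecIn.pair hf hg
  simpa [RecT, Seq.seq] using this

theorem RecT.id {O : ℕ → ℕ} : RecT O (fun n => n) := RecT.of_primrec Primrec.id

/-- apply a binary primitive recursive function -/
theorem RecT.prim2 {O f g : ℕ → ℕ} {P : ℕ → ℕ → ℕ} (hP : Primrec₂ P) (hf : RecT O f)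
    (hg : RecT O g) : RecT O (fun n => P (f n) (g n)) := by
  have h1 : RecT O (Nat.unpaired P) := RecT.of_primrec (Primrec₂.unpaired.2 hP)
  have := h1.comp (hf.pair hg)
  simpa using this

theorem RecT.rec0 {O g : ℕ → ℕ} (c : ℕ) (hg : RecT O g) :
    RecT O (fun n => Nat.rec (motive := fun _ => ℕ) c (fun y i => g (Nat.pair y i)) n) := by
  have h1 : RecT O (fun n => g n.unpair.2) :=
    hg.comp (RecT.of_primrec (Primrec.snd.comp Primrec.unpair))
  have h2 : RecT O (fun _ => c) := RecT.of_primrec (Primrec.const c)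
  have h3 := RecIn.prec h2 h1
  have h4 : RecT O (fun n => Nat.rec (motive := fun _ => ℕ) c
      (fun y i => g (Nat.pair y i)) n.unpair.2) := by
    refine RecIn.of_eq h3 fun n => ?_
    simp only [Nat.unpaired]
    induction n.unpair.2 with
    | zero => rfl
    | succ k ih => simp only [ih]; simp
  have := h4.comp (RecT.of_primrec (Primrec₂.natPair.comp (Primrec.const 0) Primrec.id))
  simpa using this

/-- table of values -/
def tbl (f : ℕ → ℕ) (n : ℕ) : List ℕ := (List.range n).map f

theorem RecT.tbl {O f : ℕ → ℕ} (hf : RecT O f) : RecT O (fun n => encode (tbl f n)) := by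
  have hP : Primrec₂ (fun l v : ℕ => encode (ofNat (List ℕ) l ++ [v])) :=
    Primrec.encode.comp (Primrec.list_concat.comp ((Primrec.ofNat _).comp Primrec.fst) Primrec.snd)
  have h1 : RecT O (fun p => encode (ofNat (List ℕ) p.unpair.2 ++ [f p.unpair.1])) :=
    RecT.prim2 hP (RecT.of_primrec (Primrec.snd.comp Primrec.unpair))
      (hf.comp (RecT.of_primrec (Primrec.fst.comp Primrec.unpair)))
  have h2 := RecT.rec0 (encode ([] : List ℕ)) h1
  convert h2 using 2 with n
  induction n with
  | zero => rfl
  | succ k ih =>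
    simp only [← ih]
    simp [_root_.tbl, List.range_succ]

theorem RecT.find {O f : ℕ → ℕ} (hf : RecT O f) (h : ∀ a, ∃ n, f (Nat.pair a n) = 0) :
    RecT O (fun a => Nat.find (h a)) := by
  have h1 := RecIn.rfind hf
  refine RecIn.of_eq h1 fun a => ?_
  rw [Part.eq_some_iff]
  refine Nat.mem_rfind.2 ⟨?_, ?_⟩
  · simpa using Nat.find_spec (h a)
  · intro m hm
    simpa using Nat.find_min (h a) hm

end

section
open scoped Classical
open Encodable Denumerable

theorem tbl_getElem? (O : ℕ → ℕ) (n x : ℕ) :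
    (tbl O n)[x]? = if x < n then some (O x) else none := by
  unfold tbl
  by_cases h : x < n
  · simp [h]
  · simp [h]

theorem RecIn.use {O : ℕ → ℕ} {f : ℕ →. ℕ} (hf : RecIn O f) :
    ∃ G : List ℕ → ℕ →. ℕ, Partrec₂ G ∧ (∀ n x y, y ∈ G (tbl O n) x → y ∈ f x) ∧
      (∀ x y, y ∈ f x → ∀ᶠ n in Filter.atTop, y ∈ G (tbl O n) x) := by
  induction hf with
  | oracle =>
    refine ⟨fun l x => (l[x]? : Option ℕ), ?_, ?_, ?_⟩
    · exact Computable.ofOption (Computable.list_getElem?.comp Computable.fst Computable.snd)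
    · intro n x y
      simp only [tbl_getElem?]
      split_ifs <;> simp
    · intro x y hy
      filter_upwards [Filter.eventually_gt_atTop x] with n hn
      simp only [tbl_getElem?, if_pos hn]
      simpa using hy
  | zero =>
    refine ⟨fun _ _ => Part.some 0, ?_, fun _ _ _ h => h, fun _ _ h => Filter.Eventually.of_forall fun _ => h⟩
    exact (Computable.const 0)
  | succ =>
    refine ⟨fun _ x => Part.some (x + 1), ?_, fun _ _ _ h => h, fun _ _ h => Filter.Eventually.of_forall fun _ => h⟩
    exact (Computable.succ.comp Computable.snd)
  | left =>
    refine ⟨fun _ x => Part.some x.unpair.1, ?_, fun _ _ _ h => h, fun _ _ h => Filter.Eventually.of_forall fun _ => h⟩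
    exact (Computable.fst.comp (Computable.unpair.comp Computable.snd))
  | right =>
    refine ⟨fun _ x => Part.some x.unpair.2, ?_, fun _ _ _ h => h, fun _ _ h => Filter.Eventually.of_forall fun _ => h⟩
    exact (Computable.snd.comp (Computable.unpair.comp Computable.snd))
  | @pair f g _ _ h1 h2 =>
    obtain ⟨F, pF, sF, cF⟩ := h1
    obtain ⟨G, pG, sG, cG⟩ := h2
    refine ⟨fun l x => (F l x).bind fun a => (G l x).map fun b => Nat.pair a b, ?_, ?_, ?_⟩
    · refine Partrec.bind pF ?_
      refine Partrec.map (pG.comp (Computable.fst.comp Computable.fst)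
        (Computable.snd.comp Computable.fst)) ?_
      exact (Primrec₂.natPair.comp (Primrec.snd.comp Primrec.fst) Primrec.snd).to_comp
    · intro n x y hy
      simp only [Part.mem_bind_iff, Part.mem_map_iff] at hy
      obtain ⟨a, ha, b, hb, rfl⟩ := hy
      have e1 := Part.eq_some_iff.2 (sF _ _ _ ha)
      have e2 := Part.eq_some_iff.2 (sG _ _ _ hb)
      simp [Seq.seq, e1, e2]
    · intro x y hy
      simp [Seq.seq] at hy
      obtain ⟨a, ha, b, hb, rfl⟩ := hy
      filter_upwards [cF _ _ ha, cG _ _ hb] with n h1 h2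
      simp only [Part.mem_bind_iff, Part.mem_map_iff]
      exact ⟨a, h1, b, h2, rfl⟩
  | @comp f g _ _ h1 h2 =>
    obtain ⟨F, pF, sF, cF⟩ := h1
    obtain ⟨G, pG, sG, cG⟩ := h2
    refine ⟨fun l x => (G l x).bind fun a => F l a, ?_, ?_, ?_⟩
    · refine Partrec.bind pG ?_
      exact pF.comp (Computable.fst.comp Computable.fst) Computable.snd
    · intro n x y hy
      simp only [Part.mem_bind_iff] at hy
      obtain ⟨a, ha, hb⟩ := hy
      exact Part.mem_bind_iff.2 ⟨a, sG _ _ _ ha, sF _ _ _ hb⟩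
    · intro x y hy
      obtain ⟨a, ha, hb⟩ := Part.mem_bind_iff.1 hy
      filter_upwards [cG _ _ ha, cF _ _ hb] with n h1 h2
      exact Part.mem_bind_iff.2 ⟨a, h1, h2⟩
  | @prec f g _ _ h1 h2 =>
    obtain ⟨F, pF, sF, cF⟩ := h1
    obtain ⟨G, pG, sG, cG⟩ := h2
    refine ⟨fun l x => Nat.rec (motive := fun _ => Part ℕ) (F l x.unpair.1)
      (fun y IH => IH.bind fun i => G l (Nat.pair x.unpair.1 (Nat.pair y i))) x.unpair.2, ?_, ?_, ?_⟩
    · refine Partrec.nat_rec (f := fun p : List ℕ × ℕ => p.2.unpair.2)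
        (g := fun p : List ℕ × ℕ => F p.1 p.2.unpair.1)
        (h := fun p q => G p.1 (Nat.pair p.2.unpair.1 (Nat.pair q.1 q.2))) ?_ ?_ ?_
      · exact (Computable.snd.comp (Computable.unpair.comp Computable.snd))
      · exact pF.comp Computable.fst (Computable.fst.comp (Computable.unpair.comp Computable.snd))
      · refine pG.comp (Computable.fst.comp Computable.fst) ?_
        refine Primrec.to_comp ?_
        exact Primrec₂.natPair.comp (Primrec.fst.comp (Primrec.unpair.comp (Primrec.snd.comp Primrec.fst)))
          (Primrec₂.natPair.comp (Primrec.fst.comp Primrec.snd) (Primrec.snd.comp Primrec.snd))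
    · intro n x
      simp only [Nat.unpaired]
      generalize x.unpair.1 = a
      generalize x.unpair.2 = k
      induction k with
      | zero => intro y hy; exact sF _ _ _ hy
      | succ k ih =>
        intro y hy
        obtain ⟨i, hi, hb⟩ := Part.mem_bind_iff.1 hy
        exact Part.mem_bind_iff.2 ⟨i, ih _ hi, sG _ _ _ hb⟩
    · intro x
      simp only [Nat.unpaired]
      generalize x.unpair.1 = a
      generalize x.unpair.2 = k
      induction k with
      | zero => intro y hy; exact cF _ _ hy
      | succ k ih =>
        intro y hy
        obtain ⟨i, hi, hb⟩ := Part.mem_bind_iff.1 hy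
        filter_upwards [ih _ hi, cG _ _ hb] with n h1 h2
        exact Part.mem_bind_iff.2 ⟨i, h1, h2⟩
  | @rfind f _ h1 =>
    obtain ⟨F, pF, sF, cF⟩ := h1
    refine ⟨fun l a => Nat.rfind fun n => (F l (Nat.pair a n)).map fun m => decide (m = 0), ?_, ?_, ?_⟩
    · refine Partrec.rfind (α := List ℕ × ℕ)
        (p := fun q n => (F q.1 (Nat.pair q.2 n)).map fun m => decide (m = 0)) ?_
      refine Partrec.map (pF.comp (Computable.fst.comp Computable.fst) ?_) ?_
      · exact (Primrec₂.natPair.comp (Primrec.snd.comp Primrec.fst) Primrec.snd).to_comp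
      · refine Primrec.to_comp ?_
        exact (Primrec.eq.decide.comp Primrec.snd (Primrec.const 0))
    · intro n x y hy
      obtain ⟨h1, h2⟩ := Nat.mem_rfind.1 hy
      refine Nat.mem_rfind.2 ⟨?_, ?_⟩
      · obtain ⟨a, ha, hb⟩ := (Part.mem_map_iff _).1 h1
        exact (Part.mem_map_iff _).2 ⟨a, sF _ _ _ ha, hb⟩
      · intro m hm
        obtain ⟨a, ha, hb⟩ := (Part.mem_map_iff _).1 (h2 hm)
        exact (Part.mem_map_iff _).2 ⟨a, sF _ _ _ ha, hb⟩
    · intro x y hy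
      obtain ⟨h1, h2⟩ := Nat.mem_rfind.1 hy
      have e2 : ∀ᶠ n in Filter.atTop, ∀ m ∈ Finset.range y,
          false ∈ (F (tbl O n) (Nat.pair x m)).map fun m => decide (m = 0) := by
        rw [Filter.eventually_all_finset]
        intro m hm
        obtain ⟨a, ha, hb⟩ := (Part.mem_map_iff _).1 (h2 (Finset.mem_range.1 hm))
        filter_upwards [cF _ _ ha] with n hn
        exact (Part.mem_map_iff _).2 ⟨a, hn, hb⟩
      obtain ⟨a, ha, hb⟩ := (Part.mem_map_iff _).1 h1
      filter_upwards [e2, cF _ _ ha] with n hn hn'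
      refine Nat.mem_rfind.2 ⟨(Part.mem_map_iff _).2 ⟨a, hn', hb⟩, ?_⟩
      intro m hm
      exact hn m (Finset.mem_range.2 hm)

end

section
open scoped Classical
open Encodable Denumerable
open Nat.Partrec (Code)

/-- translation of oracle codes into codes, for the zero oracle -/
def trC : OCode → Code
  | .zero => .zero
  | .succ => .succ
  | .left => .left
  | .right => .right
  | .oracle => .zero
  | .pair a b => .pair (trC a) (trC b)
  | .comp a b => .comp (trC a) (trC b)
  | .prec a b => .prec (trC a) (trC b)
  | .rfind' a => .rfind' (trC a)

theorem eval_trC (c : OCode) : (trC c).eval = evalo (chi ∅) c := by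
  induction c with
  | zero => rfl
  | succ => rfl
  | left => rfl
  | right => rfl
  | oracle => funext n; simp [trC, evalo, chi, Code.eval]; rfl
  | pair a b h1 h2 => simp [trC, evalo, Code.eval, h1, h2]; rfl
  | comp a b h1 h2 => simp [trC, evalo, Code.eval, h1, h2]; rfl
  | prec a b h1 h2 => simp [trC, evalo, Code.eval, h1, h2]; rfl
  | rfind' a h => simp [trC, evalo, Code.eval, h]; rfl

/-- one step of the strong recursion -/
def trStep (l : List Code) : Option Code :=
  Nat.casesOn l.length (some Code.zero) fun n1 =>
  Nat.casesOn n1 (some Code.succ) fun n2 =>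
  Nat.casesOn n2 (some Code.left) fun n3 =>
  Nat.casesOn n3 (some Code.right) fun n4 =>
  Nat.casesOn n4 (some Code.zero) fun n =>
    l[n.div2.div2.unpair.1]?.bind fun a =>
    l[n.div2.div2.unpair.2]?.bind fun b =>
    l[n.div2.div2]?.map fun c =>
    cond n.bodd (cond n.div2.bodd (Code.rfind' c) (Code.prec a b))
      (cond n.div2.bodd (Code.comp a b) (Code.pair a b))

theorem primrec_trStep : Primrec trStep := by
  unfold trStep
  refine Primrec.nat_casesOn Primrec.list_length (Primrec.const _) ?_
  refine Primrec.nat_casesOn Primrec.snd (Primrec.const _) ?_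
  refine Primrec.nat_casesOn Primrec.snd (Primrec.const _) ?_
  refine Primrec.nat_casesOn Primrec.snd (Primrec.const _) ?_
  refine Primrec.nat_casesOn Primrec.snd (Primrec.const _) ?_
  have hl : Primrec (fun p : ((((List Code × ℕ) × ℕ) × ℕ) × ℕ) × ℕ => p.1.1.1.1.1) :=
    Primrec.fst.comp (Primrec.fst.comp (Primrec.fst.comp (Primrec.fst.comp Primrec.fst)))
  have hm : Primrec (fun p : ((((List Code × ℕ) × ℕ) × ℕ) × ℕ) × ℕ => p.2.div2.div2) :=
    Primrec.nat_div2.comp (Primrec.nat_div2.comp Primrec.snd)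
  refine Primrec.option_bind (Primrec.list_getElem?.comp hl
    (Primrec.fst.comp (Primrec.unpair.comp hm))) ?_
  refine Primrec.option_bind (Primrec.list_getElem?.comp (hl.comp Primrec.fst)
    (Primrec.snd.comp (Primrec.unpair.comp (hm.comp Primrec.fst)))) ?_
  refine Primrec.option_map (Primrec.list_getElem?.comp (hl.comp (Primrec.fst.comp Primrec.fst))
    (hm.comp (Primrec.fst.comp Primrec.fst))) ?_
  have hn : Primrec (fun p : (((((((List Code × ℕ) × ℕ) × ℕ) × ℕ) × ℕ) × Code) × Code) × Code =>
    p.1.1.1.2) := Primrec.snd.comp (Primrec.fst.comp (Primrec.fst.comp Primrec.fst))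
  have ha : Primrec (fun p : (((((((List Code × ℕ) × ℕ) × ℕ) × ℕ) × ℕ) × Code) × Code) × Code =>
    p.1.1.2) := Primrec.snd.comp (Primrec.fst.comp Primrec.fst)
  have hb : Primrec (fun p : (((((((List Code × ℕ) × ℕ) × ℕ) × ℕ) × ℕ) × Code) × Code) × Code =>
    p.1.2) := Primrec.snd.comp Primrec.fst
  have h1 := Primrec.nat_bodd.comp hn
  have h2 := Primrec.nat_bodd.comp (Primrec.nat_div2.comp hn)
  exact Primrec.cond h1 (Primrec.cond h2 (Code.primrec_rfind'.comp Primrec.snd)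
    (Code.primrec₂_prec.comp ha hb))
    (Primrec.cond h2 (Code.primrec₂_comp.comp ha hb) (Code.primrec₂_pair.comp ha hb))

theorem primrec_tr : Primrec (fun e => trC (ofNatOCode e)) := by
  have := Primrec.nat_strong_rec (α := Unit) (fun _ n => trC (ofNatOCode n))
    (g := fun _ l => trStep l) (primrec_trStep.comp Primrec.snd) ?_
  · exact this.comp (Primrec.const ()) Primrec.id
  intro _ n
  match n with
  | 0 => simp [trStep, ofNatOCode, trC]
  | 1 => simp [trStep, ofNatOCode, trC]
  | 2 => simp [trStep, ofNatOCode, trC]; rfl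
  | 3 => simp [trStep, ofNatOCode, trC]; rfl
  | 4 => simp [trStep, ofNatOCode, trC]; rfl
  | n + 5 =>
    have hm : n.div2.div2 < n + 5 := by
      rw [Nat.div2_val, Nat.div2_val]
      exact lt_of_le_of_lt (le_trans (Nat.div_le_self _ _) (Nat.div_le_self _ _))
        (Nat.lt_succ_of_le (Nat.le_add_right _ 4))
    have m1 : n.div2.div2.unpair.1 < n + 5 :=
      lt_of_le_of_lt (Nat.unpair_left_le _) hm
    have m2 : n.div2.div2.unpair.2 < n + 5 :=
      lt_of_le_of_lt (Nat.unpair_right_le _) hm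
    rw [ofNatOCode]
    simp only [trStep, List.length_map, List.length_range, List.getElem?_map,
      List.getElem?_range hm, List.getElem?_range m1, List.getElem?_range m2,
      Option.map_some, Option.bind_some]
    rcases n.bodd <;> rcases n.div2.bodd <;> simp [trC]

/-- `K` is computably enumerable. -/
theorem exists_K_code : ∃ u : Code, ∀ e, e ∈ K ↔ (u.eval e).Dom := by
  have h : Partrec (fun e : ℕ => (trC (ofNatOCode e)).eval e) :=
    Code.eval_part.comp primrec_tr.to_comp Computable.id
  obtain ⟨u, hu⟩ := Code.exists_code.1 (Partrec.nat_iff.1 h)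
  refine ⟨u, fun e => ?_⟩
  rw [hu]
  simp only [eval_trC]
  rfl

end

section
open scoped Classical
open Encodable Denumerable
open Nat.Partrec (Code)

theorem primrec_ind {α : Type*} [Primcodable α] {p : α → Prop} [DecidablePred p] (hp : PrimrecPred p) :
    Primrec (fun a => if p a then 0 else 1 : α → ℕ) :=
  Primrec.ite hp (Primrec.const 0) (Primrec.const 1)

theorem primrec_ind' {α : Type*} [Primcodable α] {p : α → Prop} [DecidablePred p] (hp : PrimrecPred p) :
    Primrec (fun a => if p a then 1 else 0 : α → ℕ) :=
  Primrec.ite hp (Primrec.const 1) (Primrec.const 0)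

theorem forall_lt_prim {α : Type*} [Primcodable α] {R : ℕ → α → Prop} (hf : PrimrecRel R) :
    PrimrecRel fun (n : ℕ) (y : α) => ∀ x < n, R x y :=
  (hf.forall_mem_list.comp (Primrec.list_range.comp Primrec.fst) Primrec.snd).of_eq (by simp)

theorem exists_lt_prim {α : Type*} [Primcodable α] {R : ℕ → α → Prop} (hf : PrimrecRel R) :
    PrimrecRel fun (n : ℕ) (y : α) => ∃ x < n, R x y :=
  (hf.exists_mem_list.comp (Primrec.list_range.comp Primrec.fst) Primrec.snd).of_eq (by simp)

theorem primrec_tblget : Primrec₂ (fun l i : ℕ => (ofNat (List ℕ) l).getD i 0) :=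
  (Primrec.list_getD 0).comp ((Primrec.ofNat _).comp Primrec.fst) Primrec.snd

theorem tbl_getD {f : ℕ → ℕ} {n i : ℕ} (h : i < n) : (tbl f n).getD i 0 = f i := by
  simp [List.getD, tbl_getElem?, h]

theorem isSome_prim (u : Code) :
    PrimrecRel (fun e s : ℕ => (Code.evaln s u e).isSome = true) := by
  refine PrimrecRel.comp Primrec.eq (f := fun p : ℕ × ℕ => (Code.evaln p.2 u p.1).isSome)
    (g := fun _ => true) ?_ (Primrec.const true)
  exact Primrec.option_isSome.comp (Code.primrec_evaln.comp
    (Primrec.pair (Primrec.pair Primrec.snd (Primrec.const u)) Primrec.fst))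

theorem evaln_isSome_mono {u : Code} {e s t : ℕ} (h : s ≤ t)
    (hs : (Code.evaln s u e).isSome = true) : (Code.evaln t u e).isSome = true := by
  obtain ⟨y, hy⟩ := Option.isSome_iff_exists.1 hs
  exact Option.isSome_iff_exists.2 ⟨y, Code.evaln_mono h hy⟩

theorem exists_settle : ∃ m : ℕ → ℕ, Monotone m ∧ RecT (chi K) m ∧
    ∀ O g : ℕ → ℕ, RecT O g → (∀ n, m n ≤ g n) → RecT O (chi K) := by
  obtain ⟨u, hu⟩ := exists_K_code
  have hK : ∀ e, e ∈ K ↔ ∃ s, (Code.evaln s u e).isSome = true := by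
    intro e
    rw [hu, Part.dom_iff_mem]
    constructor
    · rintro ⟨y, hy⟩
      obtain ⟨s, hs⟩ := Code.evaln_complete.1 hy
      exact ⟨s, Option.isSome_iff_exists.2 ⟨y, hs⟩⟩
    · rintro ⟨s, hs⟩
      obtain ⟨y, hy⟩ := Option.isSome_iff_exists.1 hs
      exact ⟨y, Code.evaln_sound hy⟩
  have h0 : ∀ x, ∃ s, ∀ e < x + 1, e ∈ K → (Code.evaln s u e).isSome = true := by
    intro x
    have : ∀ e, ∃ s, e ∈ K → (Code.evaln s u e).isSome = true := by
      intro e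
      by_cases h : e ∈ K
      · obtain ⟨s, hs⟩ := (hK e).1 h
        exact ⟨s, fun _ => hs⟩
      · exact ⟨0, fun h' => absurd h' h⟩
    choose s hs using this
    refine ⟨(Finset.range (x+1)).sup s, fun e he hk => ?_⟩
    exact evaln_isSome_mono (Finset.le_sup (f := s) (Finset.mem_range.2 he)) (hs e hk)
  let P : ℕ → ℕ → ℕ := fun p l => if (∀ e < p.unpair.1 + 1, (ofNat (List ℕ) l).getD e 0 = 0 ∨
    (Code.evaln p.unpair.2 u e).isSome = true) then 0 else 1
  have hP : Primrec₂ P := by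
    refine primrec_ind (α := ℕ × ℕ) (p := fun y : ℕ × ℕ => ∀ e < y.1.unpair.1 + 1,
      (ofNat (List ℕ) y.2).getD e 0 = 0 ∨ (Code.evaln y.1.unpair.2 u e).isSome = true) ?_
    have hR : PrimrecRel (fun (e : ℕ) (y : ℕ × ℕ) => (ofNat (List ℕ) y.2).getD e 0 = 0 ∨
        (Code.evaln y.1.unpair.2 u e).isSome = true) := by
      refine PrimrecPred.or ?_ ?_
      · exact Primrec.eq.comp (primrec_tblget.comp (Primrec.snd.comp Primrec.snd) Primrec.fst)
          (Primrec.const 0)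
      · exact (isSome_prim u).comp Primrec.fst
          (Primrec.snd.comp (Primrec.unpair.comp (Primrec.fst.comp Primrec.snd)))
    have hF := forall_lt_prim hR
    exact PrimrecRel.comp hF (f := fun y : ℕ × ℕ => y.1.unpair.1 + 1) (g := fun y => y)
      (Primrec.succ.comp (Primrec.fst.comp (Primrec.unpair.comp Primrec.fst))) Primrec.id
  have h1 : RecT (chi K) (fun p => P p (encode (tbl (chi K) (p.unpair.1 + 1)))) :=
    RecT.prim2 hP RecT.id ((RecT.tbl RecIn.oracle).comp
      (RecT.of_primrec (Primrec.succ.comp (Primrec.fst.comp Primrec.unpair))))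
  have key : ∀ x s, P (Nat.pair x s) (encode (tbl (chi K) ((Nat.pair x s).unpair.1 + 1))) = 0 ↔
      ∀ e < x + 1, e ∈ K → (Code.evaln s u e).isSome = true := by
    intro x s
    simp only [P, Nat.unpair_pair, ofNat_encode]
    rw [ite_eq_left_iff]
    simp only [one_ne_zero, imp_false, not_not]
    refine forall_congr' fun e => forall_congr' fun he => ?_
    rw [tbl_getD he]
    unfold chi
    by_cases h : e ∈ K <;> simp [h]
  have h2 : ∀ x, ∃ s, P (Nat.pair x s) (encode (tbl (chi K) ((Nat.pair x s).unpair.1 + 1))) = 0 := by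
    intro x
    obtain ⟨s, hs⟩ := h0 x
    exact ⟨s, (key x s).2 hs⟩
  refine ⟨fun x => Nat.find (h2 x), ?_, RecT.find h1 h2, ?_⟩
  · intro x y hxy
    apply Nat.find_min'
    rw [key]
    have := (key y _).1 (Nat.find_spec (h2 y))
    exact fun e he => this e (by omega)
  · intro O g hg hm
    have h3 : Primrec₂ (fun e s : ℕ => if (Code.evaln s u e).isSome = true then 1 else 0 : ℕ → ℕ → ℕ) :=
      primrec_ind' (α := ℕ × ℕ)
        (p := fun y => (Code.evaln y.2 u y.1).isSome = true) (isSome_prim u)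
    have h4 := RecT.prim2 h3 RecT.id hg
    convert h4 using 2 with e
    unfold chi
    refine if_congr ?_ rfl rfl
    constructor
    · intro he
      exact evaln_isSome_mono (hm e) ((key e _).1 (Nat.find_spec (h2 e)) e (by omega) he)
    · exact fun h => (hK e).2 ⟨_, h⟩

end

section
open scoped Classical
open Encodable Denumerable

theorem encode_nnrat (q : ℚ) (k : ℕ) (h : q.num = k) : encode q = Nat.pair (2 * k) q.den := by
  have : encode q = Nat.pair (encode q.num) q.den := rfl
  rw [this, h]
  rfl

theorem primrec_pow : Primrec₂ ((· ^ ·) : ℕ → ℕ → ℕ) := Primrec₂.unpaired'.1 Nat.Primrec.pow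

theorem primrec_prod {α : Type*} [Primcodable α] {f : α → ℕ → ℕ} {n : α → ℕ}
    (hf : Primrec₂ f) (hn : Primrec n) : Primrec (fun a => ∏ i ∈ Finset.range (n a), f a i) := by
  have : Primrec (fun a => Nat.rec (motive := fun _ => ℕ) 1 (fun i r => r * f a i) (n a)) :=
    Primrec.nat_rec' hn (Primrec.const 1) (h := fun a p => p.2 * f a p.1)
      (Primrec.nat_mul.comp (Primrec.snd.comp Primrec.snd)
        (hf.comp Primrec.fst (Primrec.fst.comp Primrec.snd)))
  refine this.of_eq fun a => ?_
  induction n a with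
  | zero => rfl
  | succ k ih => rw [Finset.prod_range_succ, ← ih]

theorem primrec_sum {α : Type*} [Primcodable α] {f : α → ℕ → ℕ} {n : α → ℕ}
    (hf : Primrec₂ f) (hn : Primrec n) : Primrec (fun a => ∑ i ∈ Finset.range (n a), f a i) := by
  have : Primrec (fun a => Nat.rec (motive := fun _ => ℕ) 0 (fun i r => r + f a i) (n a)) :=
    Primrec.nat_rec' hn (Primrec.const 0) (h := fun a p => p.2 + f a p.1)
      (Primrec.nat_add.comp (Primrec.snd.comp Primrec.snd)
        (hf.comp Primrec.fst (Primrec.fst.comp Primrec.snd)))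
  refine this.of_eq fun a => ?_
  induction n a with
  | zero => rfl
  | succ k ih => rw [Finset.sum_range_succ, ← ih]

theorem primrec_gcd : Primrec₂ Nat.gcd := by
  have hd : ∀ (a : ℕ × ℕ → ℕ), Primrec a → PrimrecRel (fun (x : ℕ × ℕ) (d : ℕ) => a x % d = 0) := by
    intro a ha
    exact Primrec.eq.comp (Primrec.nat_mod.comp (ha.comp Primrec.fst) Primrec.snd) (Primrec.const 0)
  have h : PrimrecRel (fun (x : ℕ × ℕ) (d : ℕ) => x.1 % d = 0 ∧ x.2 % d = 0) :=
    PrimrecPred.and (hd _ Primrec.fst) (hd _ Primrec.snd)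
  have := Primrec.nat_findGreatest (f := fun x : ℕ × ℕ => x.1 + x.2)
    (Primrec.nat_add.comp Primrec.fst Primrec.snd) h
  refine this.of_eq ?_
  rintro ⟨a, b⟩
  simp only
  rw [Nat.findGreatest_eq_iff]
  by_cases h0 : Nat.gcd a b = 0
  · obtain ⟨rfl, rfl⟩ := Nat.gcd_eq_zero_iff.1 h0
    refine ⟨by simp, by simp, ?_⟩
    intro n hn hn'
    simp at hn hn'
    omega
  · refine ⟨?_, fun _ => ⟨Nat.mod_eq_zero_of_dvd (Nat.gcd_dvd_left a b),
      Nat.mod_eq_zero_of_dvd (Nat.gcd_dvd_right a b)⟩, ?_⟩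
    · rcases Nat.eq_zero_or_pos a with rfl | ha
      · simp
      · exact le_trans (Nat.gcd_le_left b ha) (Nat.le_add_right _ _)
    · rintro n hn _ ⟨h1, h2⟩
      have := Nat.le_of_dvd (Nat.pos_of_ne_zero h0)
        (Nat.dvd_gcd (Nat.dvd_of_mod_eq_zero h1) (Nat.dvd_of_mod_eq_zero h2))
      omega

/-- betting factor -/
def fac (v : ℕ) (p c : Bool) : ℕ := if v = 1 then (if c = p then 2 else 0) else 1

/-- capital of the `e`-th strategy -/
def Nf (v : ℕ → ℕ) (σ : List Bool) (e : ℕ) : ℕ :=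
  ∏ x ∈ Finset.range σ.length, fac (v (Nat.pair e x)) e.bodd (σ.getD x false)

/-- scaled total capital -/
def af (v : ℕ → ℕ) (σ : List Bool) : ℕ :=
  1 + ∑ e ∈ Finset.range σ.length, 2 ^ (σ.length - e - 1) * Nf v σ e

/-- the martingale -/
def Mf (v : ℕ → ℕ) (σ : List Bool) : ℚ := (af v σ : ℚ) / ((2 ^ σ.length : ℕ) : ℚ)

theorem af_congr {v w : ℕ → ℕ} {σ : List Bool}
    (h : ∀ i < σ.length * σ.length, v i = w i) : af v σ = af w σ := by
  unfold af Nf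
  congr 1
  refine Finset.sum_congr rfl fun e he => ?_
  congr 1
  refine Finset.prod_congr rfl fun x hx => ?_
  rw [h]
  rw [Finset.mem_range] at he hx
  refine lt_of_lt_of_le (Nat.pair_lt_max_add_one_sq e x) ?_
  rw [sq]
  have : max e x + 1 ≤ σ.length := by omega
  exact Nat.mul_le_mul this this

theorem primrec_fac : Primrec (fun p : ℕ × Bool × Bool => fac p.1 p.2.1 p.2.2) := by
  unfold fac
  refine Primrec.ite (Primrec.eq.comp Primrec.fst (Primrec.const 1)) ?_ (Primrec.const 1)
  exact Primrec.ite (Primrec.eq.comp (Primrec.snd.comp Primrec.snd) (Primrec.fst.comp Primrec.snd))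
    (Primrec.const 2) (Primrec.const 0)

theorem primrec_af : Primrec₂ (fun (σ : List Bool) (l : ℕ) =>
    af (fun i => (ofNat (List ℕ) l).getD i 0) σ) := by
  unfold af
  refine Primrec.nat_add.comp (Primrec.const 1) ?_
  have hN : Primrec₂ (fun (a : List Bool × ℕ) (e : ℕ) =>
      Nf (fun i => (ofNat (List ℕ) a.2).getD i 0) a.1 e) := by
    unfold Nf
    refine primrec_prod (α := (List Bool × ℕ) × ℕ) (n := fun a => a.1.1.length)
      (f := fun a x => fac ((ofNat (List ℕ) a.1.2).getD (Nat.pair a.2 x) 0) a.2.bodd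
        (a.1.1.getD x false)) ?_ (Primrec.list_length.comp (Primrec.fst.comp Primrec.fst))
    refine primrec_fac.comp (Primrec.pair ?_ (Primrec.pair ?_ ?_))
    · exact primrec_tblget.comp (Primrec.snd.comp (Primrec.fst.comp Primrec.fst))
        (Primrec₂.natPair.comp (Primrec.snd.comp Primrec.fst) Primrec.snd)
    · exact Primrec.nat_bodd.comp (Primrec.snd.comp Primrec.fst)
    · exact (Primrec.list_getD false).comp (Primrec.fst.comp (Primrec.fst.comp Primrec.fst))
        Primrec.snd
  refine primrec_sum (α := List Bool × ℕ) (n := fun a => a.1.length)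
    (f := fun a e => 2 ^ (a.1.length - e - 1) * Nf (fun i => (ofNat (List ℕ) a.2).getD i 0) a.1 e)
    ?_ (Primrec.list_length.comp Primrec.fst)
  refine Primrec.nat_mul.comp (primrec_pow.comp (Primrec.const 2) ?_) hN
  exact Primrec.nat_sub.comp (Primrec.nat_sub.comp
    (Primrec.list_length.comp (Primrec.fst.comp Primrec.fst)) Primrec.snd) (Primrec.const 1)

theorem encode_Mf (v : ℕ → ℕ) (σ : List Bool) : encode (Mf v σ) =
    Nat.pair (2 * (af v σ / Nat.gcd (af v σ) (2 ^ σ.length)))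
      (2 ^ σ.length / Nat.gcd (af v σ) (2 ^ σ.length)) := by
  set a := af v σ with ha
  set b := 2 ^ σ.length with hb
  have hbp : 0 < b := by positivity
  have hg : 0 < Nat.gcd a b := Nat.gcd_pos_of_pos_right _ hbp
  have hM : Mf v σ = (((a / Nat.gcd a b : ℕ) : ℤ) : ℚ) / (((b / Nat.gcd a b : ℕ) : ℤ) : ℚ) := by
    have hgq : ((Nat.gcd a b : ℕ) : ℚ) ≠ 0 := by exact_mod_cast hg.ne'
    have hbq : ((b : ℕ) : ℚ) ≠ 0 := by exact_mod_cast hbp.ne'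
    unfold Mf
    rw [← ha, ← hb, Int.cast_natCast, Int.cast_natCast, Rat.natCast_div _ _ (Nat.gcd_dvd_left a b),
      Rat.natCast_div _ _ (Nat.gcd_dvd_right a b)]
    field_simp
  have hpos : (0 : ℤ) < ((b / Nat.gcd a b : ℕ) : ℤ) := by
    exact_mod_cast Nat.div_pos (Nat.le_of_dvd hbp (Nat.gcd_dvd_right a b)) hg
  have hco : Nat.Coprime (((a / Nat.gcd a b : ℕ) : ℤ)).natAbs (((b / Nat.gcd a b : ℕ) : ℤ)).natAbs := by
    simp only [Int.natAbs_natCast]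
    exact Nat.coprime_div_gcd_div_gcd hg
  have hd : (Mf v σ).den = b / Nat.gcd a b := by
    have := Rat.den_div_eq_of_coprime hpos hco
    rw [← hM] at this
    exact_mod_cast this
  have hn : (Mf v σ).num = ((a / Nat.gcd a b : ℕ) : ℤ) := by
    rw [hM]
    exact Rat.num_div_eq_of_coprime hpos hco
  rw [encode_nnrat _ _ hn, hd]

theorem FRed_Mf {A : Set ℕ} {v : ℕ → ℕ} (hv : RecT (chi A) v) : FRed (Mf v) A := by
  let Q : ℕ → ℕ → ℕ := fun n l => encode ((decode (α := List Bool) n).map fun σ =>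
    Nat.pair (2 * (af (fun i => (ofNat (List ℕ) l).getD i 0) σ /
        Nat.gcd (af (fun i => (ofNat (List ℕ) l).getD i 0) σ) (2 ^ σ.length)))
      (2 ^ σ.length / Nat.gcd (af (fun i => (ofNat (List ℕ) l).getD i 0) σ) (2 ^ σ.length)))
  have hQ : Primrec₂ Q := by
    refine Primrec.encode.comp ?_
    refine Primrec.option_map (Primrec.decode.comp Primrec.fst) ?_
    have ha : Primrec (fun p : (ℕ × ℕ) × List Bool =>
        af (fun i => (ofNat (List ℕ) p.1.2).getD i 0) p.2) :=
      primrec_af.comp Primrec.snd (Primrec.snd.comp Primrec.fst)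
    have hp : Primrec (fun p : (ℕ × ℕ) × List Bool => 2 ^ p.2.length) :=
      primrec_pow.comp (Primrec.const 2) (Primrec.list_length.comp Primrec.snd)
    have hg := primrec_gcd.comp ha hp
    exact Primrec₂.natPair.comp (Primrec.nat_mul.comp (Primrec.const 2)
      (Primrec.nat_div.comp ha hg)) (Primrec.nat_div.comp hp hg)
  let len : ℕ → ℕ := fun n => ((decode (α := List Bool) n).getD []).length
  have hlen : Primrec len := Primrec.list_length.comp
    (Primrec.option_getD.comp Primrec.decode (Primrec.const []))
  have h1 : RecT (chi A) (fun n => Q n (encode (tbl v (len n * len n)))) :=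
    RecT.prim2 hQ RecT.id (hv.tbl.comp (RecT.of_primrec (Primrec.nat_mul.comp hlen hlen)))
  refine RecIn.of_eq h1 fun n => ?_
  congr 1
  simp only [Q, fnOracle, ofNat_encode, len]
  cases hσ : decode (α := List Bool) n with
  | none => rfl
  | some σ =>
    simp only [Option.map_some, Option.getD_some]
    have : af (fun i => (tbl v (σ.length * σ.length)).getD i 0) σ = af v σ :=
      af_congr fun i hi => tbl_getD hi
    rw [this, encode_some, encode_some, encode_Mf]
    rfl

end

section
open scoped Classical
open Encodable Denumerable

theorem Nf_append (v : ℕ → ℕ) (σ : List Bool) (c : Bool) (e : ℕ) :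
    Nf v (σ ++ [c]) e = Nf v σ e * fac (v (Nat.pair e σ.length)) e.bodd c := by
  unfold Nf
  rw [List.length_append, List.length_singleton, Finset.prod_range_succ]
  congr 1
  · refine Finset.prod_congr rfl fun x hx => ?_
    rw [Finset.mem_range] at hx
    simp [List.getD, List.getElem?_append_left hx]
  · simp [List.getD]

theorem Nf_add (v : ℕ → ℕ) (σ : List Bool) (e : ℕ) :
    Nf v (σ ++ [false]) e + Nf v (σ ++ [true]) e = 2 * Nf v σ e := by
  rw [Nf_append, Nf_append, ← mul_add, mul_comm]
  congr 1
  unfold fac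
  rcases e.bodd <;> by_cases h : v (Nat.pair e σ.length) = 1 <;> simp [h]

theorem Nf_one {v : ℕ → ℕ} (hv : ∀ e x, v (Nat.pair e x) = 1 → e ≤ x) {σ : List Bool} {e : ℕ}
    (h : σ.length ≤ e) : Nf v σ e = 1 := by
  unfold Nf
  refine Finset.prod_eq_one fun x hx => ?_
  rw [Finset.mem_range] at hx
  unfold fac
  rw [if_neg]
  intro h'
  have := hv _ _ h'
  omega

theorem af_add {v : ℕ → ℕ} (hv : ∀ e x, v (Nat.pair e x) = 1 → e ≤ x) (σ : List Bool) :
    af v (σ ++ [false]) + af v (σ ++ [true]) = 4 * af v σ := by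
  unfold af
  simp only [List.length_append, List.length_singleton, Finset.sum_range_succ]
  have h1 : ∀ c, ∑ e ∈ Finset.range σ.length, 2 ^ (σ.length + 1 - e - 1) * Nf v (σ ++ [c]) e
      = ∑ e ∈ Finset.range σ.length, 2 * (2 ^ (σ.length - e - 1) * Nf v (σ ++ [c]) e) := by
    intro c
    refine Finset.sum_congr rfl fun e he => ?_
    rw [Finset.mem_range] at he
    have : σ.length + 1 - e - 1 = (σ.length - e - 1) + 1 := by omega
    rw [this, pow_succ]
    ring
  rw [h1, h1]
  have h2 : ∑ e ∈ Finset.range σ.length, 2 * (2 ^ (σ.length - e - 1) * Nf v (σ ++ [false]) e) +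
      ∑ e ∈ Finset.range σ.length, 2 * (2 ^ (σ.length - e - 1) * Nf v (σ ++ [true]) e) =
      4 * ∑ e ∈ Finset.range σ.length, 2 ^ (σ.length - e - 1) * Nf v σ e := by
    rw [← Finset.sum_add_distrib, Finset.mul_sum]
    refine Finset.sum_congr rfl fun e he => ?_
    have := Nf_add v σ e
    rw [← mul_add, ← mul_add, this]
    ring
  have h3 := Nf_add v σ σ.length
  rw [Nf_one hv le_rfl] at h3
  have h4 : σ.length + 1 - σ.length - 1 = 0 := by omega
  rw [h4]
  omega

theorem isMartingale_Mf {v : ℕ → ℕ} (hv : ∀ e x, v (Nat.pair e x) = 1 → e ≤ x) :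
    IsMartingale (Mf v) := by
  refine ⟨fun σ => by unfold Mf; positivity, fun σ => ?_⟩
  have h := af_add hv σ
  have h' : (af v (σ ++ [false]) : ℚ) + af v (σ ++ [true]) = 4 * af v σ := by exact_mod_cast h
  unfold Mf
  simp only [List.length_append, List.length_singleton, pow_succ, Nat.cast_mul]
  have hp : (((2 ^ σ.length : ℕ)) : ℚ) ≠ 0 := by positivity
  push_cast at hp ⊢
  field_simp
  linarith

theorem seg_length (A : Set ℕ) (n : ℕ) : (seg A n).length = n := by simp [seg]

theorem seg_succ (A : Set ℕ) (n : ℕ) :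
    seg A (n + 1) = seg A n ++ [if n ∈ A then true else false] := by
  simp [seg, List.range_succ]

theorem succeeds_Mf {v : ℕ → ℕ} {A : Set ℕ} {e : ℕ}
    (hinf : ∀ n, ∃ x, n ≤ x ∧ v (Nat.pair e x) = 1)
    (hA : ∀ x, v (Nat.pair e x) = 1 → (x ∈ A ↔ e.bodd = true)) : Succeeds (Mf v) A := by
  have step : ∀ n, Nf v (seg A (n+1)) e =
      Nf v (seg A n) e * (if v (Nat.pair e n) = 1 then 2 else 1) := by
    intro n
    rw [seg_succ, Nf_append, seg_length]
    congr 1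
    unfold fac
    by_cases h : v (Nat.pair e n) = 1
    · have := hA n h
      by_cases hn : n ∈ A
      · simp [h, hn, this.1 hn]
      · have h2 : e.bodd = false := by
          rw [← Bool.not_eq_true]; exact fun h => hn (this.2 h)
        simp [h, hn, h2]
    · simp [h]
  have mono : Monotone (fun n => Nf v (seg A n) e) := by
    refine monotone_nat_of_le_succ fun n => ?_
    rw [step]
    refine Nat.le_mul_of_pos_right _ ?_
    split_ifs <;> norm_num
  have grow : ∀ k, ∃ n, 2 ^ k ≤ Nf v (seg A n) e := by
    intro k
    induction k with
    | zero => exact ⟨0, by simp [Nf, seg]⟩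
    | succ k ih =>
      obtain ⟨n, hn⟩ := ih
      obtain ⟨x, hx, hv⟩ := hinf n
      refine ⟨x + 1, ?_⟩
      rw [step, if_pos hv, pow_succ]
      exact Nat.mul_le_mul_right _ (hn.trans (mono hx))
  intro q
  obtain ⟨k, hk⟩ := pow_unbounded_of_one_lt (q * 2 ^ (e + 1)) (by norm_num : (1 : ℚ) < 2)
  obtain ⟨n0, hn0⟩ := grow k
  let n := max n0 (e + 1)
  have hn : 2 ^ k ≤ Nf v (seg A n) e := hn0.trans (mono (le_max_left _ _))
  have hne : e + 1 ≤ n := le_max_right _ _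
  refine ⟨n, ?_⟩
  have h1 : 2 ^ (n - e - 1) * Nf v (seg A n) e ≤ af v (seg A n) := by
    unfold af
    rw [seg_length]
    refine le_trans ?_ (Nat.le_add_left _ _)
    exact Finset.single_le_sum (f := fun e => 2 ^ (n - e - 1) * Nf v (seg A n) e)
      (fun _ _ => Nat.zero_le _) (Finset.mem_range.2 (by omega))
  have h2 : 2 ^ (n - e - 1) * 2 ^ k ≤ af v (seg A n) := le_trans (Nat.mul_le_mul_left _ hn) h1
  have h3 : (2 : ℚ) ^ (n - e - 1) * 2 ^ k ≤ af v (seg A n) := by exact_mod_cast h2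
  unfold Mf
  rw [seg_length, lt_div_iff₀ (by positivity)]
  refine lt_of_lt_of_le ?_ h3
  have h4 : n = (n - e - 1) + (e + 1) := by omega
  have h5 : ((2 ^ n : ℕ) : ℚ) = 2 ^ (n - e - 1) * 2 ^ (e + 1) := by
    rw [← pow_add, ← h4]; push_cast; rfl
  rw [h5]
  have h6 : (0 : ℚ) < 2 ^ (n - e - 1) := by positivity
  nlinarith

end

section
open scoped Classical
open Encodable Denumerable
open Nat.Partrec (Code)

/-- step-bounded simulation with a finite oracle -/
def Wb (e t x : ℕ) (l : List ℕ) : Prop :=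
  Code.evaln t.unpair.1 (ofNat Code e) (encode (l.take t.unpair.2, x)) = some 1

theorem Wb_prim {α : Type*} [Primcodable α] {e t x : α → ℕ} {l : α → List ℕ} (he : Primrec e)
    (ht : Primrec t) (hx : Primrec x) (hl : Primrec l) :
    PrimrecPred (fun a => Wb (e a) (t a) (x a) (l a)) := by
  unfold Wb
  refine Primrec.eq.comp ?_ (Primrec.const (some 1))
  refine Code.primrec_evaln.comp (Primrec.pair (Primrec.pair ?_ ?_) ?_)
  · exact Primrec.fst.comp (Primrec.unpair.comp ht)
  · exact (Primrec.ofNat Code).comp he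
  · exact Primrec.encode.comp (Primrec.pair
      (Primrec.list_take.comp (Primrec.snd.comp (Primrec.unpair.comp ht)) hl) hx)

theorem take_tbl (f : ℕ → ℕ) {n k : ℕ} (h : k ≤ n) : (tbl f n).take k = tbl f k := by
  unfold tbl
  rw [← List.map_take, List.take_range, min_eq_left h]

/-- the betting table -/
noncomputable def vf (D : Set ℕ) (m : ℕ → ℕ) (p : ℕ) : ℕ :=
  if p.unpair.1 ≤ p.unpair.2 ∧ ∃ t < m p.unpair.2 + 1,
    Wb p.unpair.1.div2 t p.unpair.2 (tbl (chi D) (m p.unpair.2 + 1)) then 1 else 0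

theorem vf_rec {D : Set ℕ} {m : ℕ → ℕ} {O : ℕ → ℕ} (hD : RecT O (chi D)) (hm : RecT O m) :
    RecT O (vf D m) := by
  let P : ℕ → ℕ → ℕ := fun q l =>
    if q.unpair.1.unpair.1 ≤ q.unpair.1.unpair.2 ∧ ∃ t < q.unpair.2 + 1,
      Wb q.unpair.1.unpair.1.div2 t q.unpair.1.unpair.2 (ofNat (List ℕ) l) then 1 else 0
  have hP : Primrec₂ P := by
    refine primrec_ind' (α := ℕ × ℕ) (p := fun y => y.1.unpair.1.unpair.1 ≤ y.1.unpair.1.unpair.2 ∧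
      ∃ t < y.1.unpair.2 + 1,
      Wb y.1.unpair.1.unpair.1.div2 t y.1.unpair.1.unpair.2 (ofNat (List ℕ) y.2)) ?_
    have h1 : Primrec (fun y : ℕ × ℕ => y.1.unpair.1.unpair.1) :=
      Primrec.fst.comp (Primrec.unpair.comp (Primrec.fst.comp (Primrec.unpair.comp Primrec.fst)))
    have h2 : Primrec (fun y : ℕ × ℕ => y.1.unpair.1.unpair.2) :=
      Primrec.snd.comp (Primrec.unpair.comp (Primrec.fst.comp (Primrec.unpair.comp Primrec.fst)))
    refine PrimrecPred.and (Primrec.nat_le.comp h1 h2) ?_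
    have hR : PrimrecRel (fun (t : ℕ) (y : ℕ × ℕ) =>
        Wb y.1.unpair.1.unpair.1.div2 t y.1.unpair.1.unpair.2 (ofNat (List ℕ) y.2)) :=
      Wb_prim (Primrec.nat_div2.comp (h1.comp Primrec.snd)) Primrec.fst (h2.comp Primrec.snd)
        ((Primrec.ofNat _).comp (Primrec.snd.comp Primrec.snd))
    have hE := exists_lt_prim hR
    exact PrimrecRel.comp hE (f := fun y : ℕ × ℕ => y.1.unpair.2 + 1) (g := fun y => y)
      (Primrec.succ.comp (Primrec.snd.comp (Primrec.unpair.comp Primrec.fst))) Primrec.id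
  have hm' : RecT O (fun p => m p.unpair.2) :=
    hm.comp (RecT.of_primrec (Primrec.snd.comp Primrec.unpair))
  have := RecT.prim2 hP (RecT.id.pair hm')
    (hD.tbl.comp ((RecT.of_primrec Primrec.succ).comp hm'))
  convert this using 2 with p
  simp only [vf, P, Nat.unpair_pair, ofNat_encode, Nat.succ_eq_add_one]

theorem use_code {D S : Set ℕ} (h : TRed S D) : ∃ c : ℕ,
    (∀ t x n, t.unpair.2 ≤ n → Wb c t x (tbl (chi D) n) → x ∈ S) ∧
    (∀ x ∈ S, ∃ t, ∀ n, t.unpair.2 ≤ n → Wb c t x (tbl (chi D) n)) := by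
  obtain ⟨G, pG, sG, cG⟩ := RecIn.use h
  obtain ⟨c, hc⟩ := Code.exists_code.1 pG
  have hc' : ∀ l x, c.eval (encode ((l, x) : List ℕ × ℕ)) = G l x := by
    intro l x
    rw [hc]
    simp only [encodek, Part.coe_some, Part.bind_some, Encodable.encode_nat]
    exact Part.map_id' (fun _ => rfl) _
  refine ⟨encode c, ?_, ?_⟩
  · intro t x n hn hw
    unfold Wb at hw
    rw [take_tbl _ hn, ofNat_encode] at hw
    have h1 := Code.evaln_sound (Option.mem_def.2 hw)
    rw [hc'] at h1
    have h2 := sG _ _ _ h1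
    simp only [Part.mem_some_iff, chi] at h2
    by_contra hx
    simp [hx] at h2
  · intro x hx
    obtain ⟨k, hk⟩ := (cG x 1 (by simp [chi, hx])).exists
    rw [← hc'] at hk
    obtain ⟨s, hs⟩ := Code.evaln_complete.1 hk
    refine ⟨Nat.pair s k, fun n hn => ?_⟩
    unfold Wb
    rw [take_tbl _ hn, ofNat_encode]
    simpa using hs

theorem reduce_of_finite {D S : Set ℕ} {m : ℕ → ℕ} (hmono : Monotone m)
    (hm : ∀ O g : ℕ → ℕ, RecT O g → (∀ n, m n ≤ g n) → RecT O (chi K))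
    (hS : S.Infinite) {c e N : ℕ}
    (hc : ∀ x ∈ S, ∃ t, ∀ n, t.unpair.2 ≤ n → Wb c t x (tbl (chi D) n))
    (he : e.div2 = c) (hN : ∀ x, N ≤ x → vf D m (Nat.pair e x) ≠ 1) : TRed K D := by
  let P : ℕ → ℕ → ℕ := fun p l => if p.unpair.1 + (N + e) ≤ p.unpair.2.unpair.1 ∧
    Wb c p.unpair.2.unpair.2 p.unpair.2.unpair.1 (ofNat (List ℕ) l) then 0 else 1
  have hP : Primrec₂ P := by
    refine primrec_ind (α := ℕ × ℕ) (p := fun y => y.1.unpair.1 + (N + e) ≤ y.1.unpair.2.unpair.1 ∧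
      Wb c y.1.unpair.2.unpair.2 y.1.unpair.2.unpair.1 (ofNat (List ℕ) y.2)) ?_
    have h1 : Primrec (fun y : ℕ × ℕ => y.1.unpair.2.unpair.1) :=
      Primrec.fst.comp (Primrec.unpair.comp (Primrec.snd.comp (Primrec.unpair.comp Primrec.fst)))
    have h2 : Primrec (fun y : ℕ × ℕ => y.1.unpair.2.unpair.2) :=
      Primrec.snd.comp (Primrec.unpair.comp (Primrec.snd.comp (Primrec.unpair.comp Primrec.fst)))
    refine PrimrecPred.and (Primrec.nat_le.comp (Primrec.nat_add.comp
      (Primrec.fst.comp (Primrec.unpair.comp Primrec.fst)) (Primrec.const _)) h1) ?_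
    exact Wb_prim (Primrec.const c) h2 h1 ((Primrec.ofNat _).comp Primrec.snd)
  have h1 : RecT (chi D) (fun p => P p (encode (tbl (chi D) p.unpair.2.unpair.2.unpair.2))) :=
    RecT.prim2 hP RecT.id ((RecT.tbl RecIn.oracle).comp (RecT.of_primrec
      (Primrec.snd.comp (Primrec.unpair.comp (Primrec.snd.comp (Primrec.unpair.comp
        (Primrec.snd.comp Primrec.unpair)))))))
  have key : ∀ a z, P (Nat.pair a z)
      (encode (tbl (chi D) (Nat.pair a z).unpair.2.unpair.2.unpair.2)) = 0 ↔
      (a + (N + e) ≤ z.unpair.1 ∧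
        Wb c z.unpair.2 z.unpair.1 (tbl (chi D) z.unpair.2.unpair.2)) := by
    intro a z
    simp only [P, Nat.unpair_pair, ofNat_encode]
    rw [ite_eq_left_iff]
    simp only [one_ne_zero, imp_false, not_not]
  have h2 : ∀ a, ∃ z, P (Nat.pair a z)
      (encode (tbl (chi D) (Nat.pair a z).unpair.2.unpair.2.unpair.2)) = 0 := by
    intro a
    obtain ⟨x, hx, hax⟩ := hS.exists_gt (a + (N + e))
    obtain ⟨t, ht⟩ := hc x hx
    refine ⟨Nat.pair x t, (key _ _).2 ?_⟩
    simp only [Nat.unpair_pair]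
    exact ⟨hax.le, ht _ le_rfl⟩
  have h3 := RecT.find h1 h2
  refine hm _ _ ((RecT.of_primrec (Primrec.snd.comp Primrec.unpair)).comp h3) fun a => ?_
  obtain ⟨hz1, hz2⟩ := (key a _).1 (Nat.find_spec (h2 a))
  set z := Nat.find (h2 a)
  by_contra hlt
  push Not at hlt
  have hax : m a ≤ m z.unpair.1 := hmono (by omega)
  apply hN z.unpair.1 (by omega)
  unfold vf
  rw [if_pos]
  simp only [Nat.unpair_pair]
  refine ⟨by omega, z.unpair.2, by omega, ?_⟩
  have h5 := Nat.unpair_right_le z.unpair.2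
  unfold Wb at hz2 ⊢
  rw [take_tbl _ le_rfl] at hz2
  rw [take_tbl _ (by omega), he]
  exact hz2

/-- the only `Δ⁰₂` almost s-Ramsey degree is `0'`. -/
theorem stmt1 (D : Set ℕ) (hD : TRed D K)
    (h : ∀ M : List Bool → ℚ, IsMartingale M → FRed M K →
      ∃ A : Set ℕ, TRed A K ∧ ¬ Succeeds M A ∧
        ∃ S : Set ℕ, S.Infinite ∧ (S ⊆ A ∨ S ⊆ Aᶜ) ∧ TRed S D) :
    TRed K D := by
  obtain ⟨m, hmono, hmK, hm⟩ := exists_settle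
  have hv : RecT (chi K) (vf D m) := vf_rec hD hmK
  have hle : ∀ e x, vf D m (Nat.pair e x) = 1 → e ≤ x := by
    intro e x hx
    unfold vf at hx
    split_ifs at hx with h'
    simpa using h'.1
  obtain ⟨A, _, hA, S, hS, hSA, hSD⟩ := h _ (isMartingale_Mf hle) (FRed_Mf hv)
  obtain ⟨c, hc1, hc2⟩ := use_code hSD
  obtain ⟨b, hb⟩ : ∃ b : Bool, ∀ x ∈ S, (x ∈ A ↔ b = true) := by
    rcases hSA with h' | h'
    · exact ⟨true, fun x hx => by simp [h' hx]⟩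
    · exact ⟨false, fun x hx => by simpa using h' hx⟩
  have he1 : (Nat.bit b c).div2 = c := Nat.div2_bit b c
  have he2 : (Nat.bit b c).bodd = b := Nat.bodd_bit b c
  by_cases hinf : ∀ n, ∃ x, n ≤ x ∧ vf D m (Nat.pair (Nat.bit b c) x) = 1
  · exfalso
    refine hA (succeeds_Mf hinf fun x hx => ?_)
    rw [he2]
    apply hb
    unfold vf at hx
    split_ifs at hx with h'
    simp only [Nat.unpair_pair, he1] at h'
    obtain ⟨_, t, ht, hw⟩ := h'
    exact hc1 t x _ ((Nat.unpair_right_le t).trans (by omega)) hw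
  · push Not at hinf
    obtain ⟨N, hN⟩ := hinf
    exact reduce_of_finite hmono hm hS hc2 he1 hN

end
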